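/- arXiv:2208.12407 — 2 statements merged into one kernel-verified Lean document; each statement's English description precedes it below -/
import Mathlib

section
/- Let n ≥ 1, let A, B ∈ ℙ_n, let t ∈ (0,1), and let α ∈ (0,1) be such that A ≥ α I and B ≥ α I in the Loewner order. Then for every s with 0 < s < min{ t, 1/(−1 + log₂(α^{t−1} + α^{−t−1})) }, the matrix 2^{1+t} (A^s + B^{-s})^{-t} − A^{-s} is positive definite. -/
open Matrix
open scoped ComplexOrder

/-- Real power `A^t = exp(t · log A)` of a Hermitian positive definite matrix, defined via
the functional calculus (spectral decomposition). -/
noncomputable def mpow {n : ℕ} (A : Matrix (Fin n) (Fin n) ℂ) (t : ℝ) :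
    Matrix (Fin n) (Fin n) ℂ :=
  if hA : A.IsHermitian then
    (hA.eigenvectorUnitary : Matrix (Fin n) (Fin n) ℂ) *
      Matrix.diagonal (fun i => ((hA.eigenvalues i ^ t : ℝ) : ℂ)) *
      (star (hA.eigenvectorUnitary : Matrix (Fin n) (Fin n) ℂ))
  else A

/-- Logarithm of a Hermitian positive definite matrix via the functional calculus. -/
noncomputable def mlog {n : ℕ} (A : Matrix (Fin n) (Fin n) ℂ) : Matrix (Fin n) (Fin n) ℂ :=
  if hA : A.IsHermitian then
    (hA.eigenvectorUnitary : Matrix (Fin n) (Fin n) ℂ) *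
      Matrix.diagonal (fun i => ((Real.log (hA.eigenvalues i) : ℝ) : ℂ)) *
      (star (hA.eigenvectorUnitary : Matrix (Fin n) (Fin n) ℂ))
  else A

/-- Metric geometric mean `A # B = A^{1/2} (A^{-1/2} B A^{-1/2})^{1/2} A^{1/2}`. -/
noncomputable def geomMean {n : ℕ} (A B : Matrix (Fin n) (Fin n) ℂ) :
    Matrix (Fin n) (Fin n) ℂ :=
  mpow A (1/2) * mpow (mpow A (-(1/2)) * B * mpow A (-(1/2))) (1/2) * mpow A (1/2)

/-- Weighted spectral geometric mean `A ♮_t B = (A⁻¹ # B)^t A (A⁻¹ # B)^t`. -/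
noncomputable def spectralMean {n : ℕ} (t : ℝ) (A B : Matrix (Fin n) (Fin n) ℂ) :
    Matrix (Fin n) (Fin n) ℂ :=
  mpow (geomMean A⁻¹ B) t * A * mpow (geomMean A⁻¹ B) t

section CStarAlgebra

variable {𝓐 : Type*} [CStarAlgebra 𝓐] [PartialOrder 𝓐] [StarOrderedRing 𝓐]

/-- Operator antitonicity of `a ↦ a ^ (-p)` for `p ∈ (0, 1]` on strictly positive elements. -/
theorem CFC.rpow_neg_le_rpow_neg {p : ℝ} (hp : p ∈ Set.Ioc 0 1) {a b : 𝓐}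
    (ha : IsStrictlyPositive a) (hab : a ≤ b) : b ^ (-p) ≤ a ^ (-p) := by
  have hb : IsStrictlyPositive b := ha.of_le hab
  have h := CStarAlgebra.ringInverse_le_ringInverse
    (CFC.rpow_le_rpow (Set.Ioc_subset_Icc_self hp) hab) (ha.rpow a p)
  rwa [CFC.inverse_rpow a p hp.1.ne', CFC.inverse_rpow b p hp.1.ne'] at h

/-- A lower bound for `(a ^ s + y) ^ (-t)`, where `y ≤ c`, by a function of `a` alone. -/
theorem isStrictlyPositive_smul_rpow_neg_sub {α c k s t : ℝ} {a y : 𝓐} (hα : 0 < α)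
    (ht : t ∈ Set.Ioc 0 1) (hc : 0 < c) (hk : 0 ≤ k) (ha : algebraMap ℝ 𝓐 α ≤ a)
    (hy : 0 ≤ y) (hyc : y ≤ algebraMap ℝ 𝓐 c)
    (h : ∀ x, α ≤ x → x ^ (-s) < k * (x ^ s + c) ^ (-t)) :
    IsStrictlyPositive (k • (a ^ s + y) ^ (-t) - a ^ (-s)) := by
  have hsp : IsStrictlyPositive a := (isStrictlyPositive_algebraMap hα).of_le ha
  have hspec : ∀ x ∈ spectrum ℝ a, α ≤ x :=
    (algebraMap_le_iff_le_spectrum hsp.isSelfAdjoint).1 ha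
  have hcont (r : ℝ) : ContinuousOn (fun x : ℝ => x ^ r) (spectrum ℝ a) := fun x hx =>
    (Real.continuousAt_rpow_const x r (.inl (hα.trans_le (hspec x hx)).ne')).continuousWithinAt
  have hpos : ∀ x ∈ spectrum ℝ a, 0 < x ^ s + c := fun x hx => by
    have := hα.trans_le (hspec x hx)
    positivity
  have hcont' : ContinuousOn (fun x : ℝ => (x ^ s + c) ^ (-t)) (spectrum ℝ a) :=
    ((hcont s).add continuousOn_const).rpow_const fun x hx => .inl (hpos x hx).ne'
  have hsum : a ^ s + algebraMap ℝ 𝓐 c = cfc (fun x : ℝ => x ^ s + c) a := by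
    rw [cfc_add_const c _ a (hcont s), CFC.rpow_eq_cfc_real]
  have hrpow : (a ^ s + algebraMap ℝ 𝓐 c) ^ (-t) =
      cfc (fun x : ℝ => (x ^ s + c) ^ (-t)) a := by
    rw [hsum, CFC.cfc_rpow fun x hx => hpos x hx]
  have hmain : IsStrictlyPositive
      (k • (a ^ s + algebraMap ℝ 𝓐 c) ^ (-t) - a ^ (-s)) := by
    rw [hrpow, CFC.rpow_eq_cfc_real (a := a), ← cfc_smul k _ a hcont',
      ← cfc_sub (fun x : ℝ => k • (x ^ s + c) ^ (-t)) _ a (hcont'.const_smul k) (hcont _),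
      cfc_isStrictlyPositive_iff (fun x : ℝ => k • (x ^ s + c) ^ (-t) - x ^ (-s)) a
        ((hcont'.const_smul k).sub (hcont _))]
    exact fun x hx => sub_pos.2 (h x (hspec x hx))
  refine hmain.of_le (sub_le_sub_right (smul_le_smul_of_nonneg_left ?_ hk) _)
  exact CFC.rpow_neg_le_rpow_neg ht ((hsp.rpow a s).add_nonneg hy) (by gcongr)

end CStarAlgebra

section MatrixPower

open scoped MatrixOrder Matrix.Norms.L2Operator

variable {n : ℕ} {A : Matrix (Fin n) (Fin n) ℂ}

theorem mpow_eq_rpow (hA : 0 ≤ A) (t : ℝ) : mpow A t = A ^ t := by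
  have hH : A.IsHermitian := (nonneg_iff_posSemidef.1 hA).isHermitian
  rw [CFC.rpow_eq_cfc_real, hH.cfc_eq, mpow, dif_pos hH]
  rfl

end MatrixPower

section Scalar

variable {α s t x : ℝ}

theorem rpow_mean_lt (hα : 0 < α) (hs : 0 < s) (hst : s ≤ t)
    (h : s * Real.logb 2 ((α ^ (t - 1) + α ^ (-t - 1)) / 2) < 1) :
    ((α ^ s + α ^ (-s)) / 2) ^ t < 2 * α ^ s := by
  have ht : 0 < t := hs.trans_le hst
  have hmean : ((α ^ s + α ^ (-s)) / 2) ^ (t / s) ≤ (α ^ t + α ^ (-t)) / 2 := by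
    have hconv := (convexOn_rpow ((one_le_div hs).2 hst)).2
      (show 0 ≤ α ^ s by positivity) (show 0 ≤ α ^ (-s) by positivity)
      (show (0 : ℝ) ≤ 1 / 2 by norm_num) (show (0 : ℝ) ≤ 1 / 2 by norm_num) (by norm_num)
    simp only [smul_eq_mul] at hconv
    rw [← Real.rpow_mul hα.le, ← Real.rpow_mul hα.le, neg_mul, mul_div_cancel₀ _ hs.ne',
      ← mul_add, ← mul_add, one_div_mul_eq_div, one_div_mul_eq_div] at hconv
    exact hconv
  have hfac : (α ^ (t - 1) + α ^ (-t - 1)) / 2 = (α ^ t + α ^ (-t)) / 2 / α := by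
    rw [Real.rpow_sub_one hα.ne', Real.rpow_sub_one hα.ne']
    ring
  have hlt : ((α ^ t + α ^ (-t)) / 2 / α) ^ s < 2 := by
    rw [← hfac, ← Real.rpow_one 2, ← Real.logb_lt_iff_lt_rpow one_lt_two (by positivity),
      Real.logb_rpow_eq_mul_logb_of_pos (by positivity)]
    simpa using h
  calc ((α ^ s + α ^ (-s)) / 2) ^ t = (((α ^ s + α ^ (-s)) / 2) ^ (t / s)) ^ s := by
        rw [← Real.rpow_mul (by positivity), div_mul_cancel₀ _ hs.ne']
    _ ≤ ((α ^ t + α ^ (-t)) / 2) ^ s := by gcongr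
    _ < 2 * α ^ s := by
        rwa [Real.div_rpow (by positivity) hα.le, div_lt_iff₀ (by positivity)] at hlt

theorem rpow_neg_lt_mul_rpow_neg (hα : 0 < α) (hs : 0 < s) (ht : 0 < t) (ht1 : t ≤ 1)
    (h : ((α ^ s + α ^ (-s)) / 2) ^ t < 2 * α ^ s) (hx : α ≤ x) :
    x ^ (-s) < 2 ^ (1 + t) * (x ^ s + α ^ (-s)) ^ (-t) := by
  have hx0 : 0 < x := hα.trans_le hx
  set u := α ^ s with hu
  set v := x ^ s with hv
  set c := α ^ (-s) with hc
  have hu0 : 0 < u := by positivity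
  have hv0 : 0 < v := by positivity
  have hc0 : 0 < c := by positivity
  have huv : 1 ≤ v / u := (one_le_div hu0).2 (Real.rpow_le_rpow hα.le hx hs.le)
  have key : ((v + c) / 2) ^ t < 2 * v := by
    calc ((v + c) / 2) ^ t ≤ (v / u * ((u + c) / 2)) ^ t := by
          gcongr
          have : v / u * ((u + c) / 2) = (v + v / u * c) / 2 := by field_simp
          rw [this]
          nlinarith
      _ = (v / u) ^ t * ((u + c) / 2) ^ t := Real.mul_rpow (by positivity) (by positivity)
      _ ≤ v / u * ((u + c) / 2) ^ t := by
          gcongr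
          simpa using Real.rpow_le_rpow_of_exponent_le huv ht1
      _ < v / u * (2 * u) := by gcongr
      _ = 2 * v := by field_simp
  rw [Real.div_rpow (by positivity) (by positivity), div_lt_iff₀ (by positivity)] at key
  rw [Real.rpow_neg hx0.le, Real.rpow_neg (by positivity), Real.rpow_add two_pos, Real.rpow_one,
    ← div_eq_mul_inv, lt_div_iff₀ (by positivity), inv_mul_lt_iff₀ (by positivity)]
  linarith

/-- The bound on `s` in the main theorem, with the division cleared. -/
theorem mul_logb_lt_one (hα : α ∈ Set.Ioo (0 : ℝ) 1)
    (h : s < 1 / (-1 + Real.logb 2 (α ^ (t - 1) + α ^ (-t - 1)))) :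
    s * Real.logb 2 ((α ^ (t - 1) + α ^ (-t - 1)) / 2) < 1 := by
  have hα0 := hα.1
  have hlog : Real.logb 2 ((α ^ (t - 1) + α ^ (-t - 1)) / 2) =
      -1 + Real.logb 2 (α ^ (t - 1) + α ^ (-t - 1)) := by
    rw [Real.logb_div (by positivity) two_ne_zero, Real.logb_self_eq_one one_lt_two]
    ring
  rw [← hlog] at h
  refine (lt_div_iff₀ (Real.logb_pos one_lt_two ?_)).1 h
  have hprod : α ^ (t - 1) * α ^ (-t - 1) = α ^ (-2 : ℝ) := by
    rw [← Real.rpow_add hα0]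
    ring_nf
  have hone : 1 < α ^ (-2 : ℝ) :=
    Real.one_lt_rpow_of_pos_of_lt_one_of_neg hα0 hα.2 (by norm_num)
  have h1 : 0 < α ^ (t - 1) := by positivity
  have h2 : 0 < α ^ (-t - 1) := by positivity
  nlinarith [sq_nonneg (α ^ (t - 1) - α ^ (-t - 1))]

end Scalar

theorem lower_bound_posDef {n : ℕ} (hn : 1 ≤ n) (A B : Matrix (Fin n) (Fin n) ℂ)
    (hA : A.PosDef) (hB : B.PosDef) (t : ℝ) (ht : t ∈ Set.Ioo (0 : ℝ) 1)
    (α : ℝ) (hα : α ∈ Set.Ioo (0 : ℝ) 1)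
    (hAα : (A - α • (1 : Matrix (Fin n) (Fin n) ℂ)).PosSemidef)
    (hBα : (B - α • (1 : Matrix (Fin n) (Fin n) ℂ)).PosSemidef)
    (s : ℝ) (hs : 0 < s)
    (hs' : s < min t (1 / (-1 + Real.logb 2 (α ^ (t - 1) + α ^ (-t - 1))))) :
    (((2 : ℝ) ^ (1 + t)) • mpow (mpow A s + mpow B (-s)) (-t) - mpow A (-s)).PosDef := by
  open scoped MatrixOrder Matrix.Norms.L2Operator in
  have hle {M : Matrix (Fin n) (Fin n) ℂ}
      (hM : (M - α • (1 : Matrix (Fin n) (Fin n) ℂ)).PosSemidef) :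
      algebraMap ℝ (Matrix (Fin n) (Fin n) ℂ) α ≤ M := by
    rwa [Algebra.algebraMap_eq_smul_one, le_iff]
  have hA0 : 0 ≤ A := nonneg_iff_posSemidef.2 hA.posSemidef
  have hB0 : 0 ≤ B := nonneg_iff_posSemidef.2 hB.posSemidef
  have hspec : ∀ x ∈ spectrum ℝ B, α ≤ x :=
    (algebraMap_le_iff_le_spectrum hB0.isSelfAdjoint).1 (hle hBα)
  have hcont : ContinuousOn (fun x : ℝ => x ^ (-s)) (spectrum ℝ B) := fun x hx =>
    (Real.continuousAt_rpow_const x _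
      (.inl (hα.1.trans_le (hspec x hx)).ne')).continuousWithinAt
  have hY : B ^ (-s) ≤ algebraMap ℝ (Matrix (Fin n) (Fin n) ℂ) (α ^ (-s)) := by
    rw [CFC.rpow_eq_cfc_real]
    refine cfc_le_algebraMap _ _ _ fun x hx => ?_
    exact Real.rpow_le_rpow_of_nonpos hα.1
      (hspec x hx) (by linarith)
  rw [mpow_eq_rpow hA0, mpow_eq_rpow hA0, mpow_eq_rpow hB0,
    mpow_eq_rpow (add_nonneg CFC.rpow_nonneg CFC.rpow_nonneg), ← isStrictlyPositive_iff_posDef]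
  have hscalar := rpow_mean_lt hα.1 hs (hs'.trans_le (min_le_left _ _)).le
    (mul_logb_lt_one hα (hs'.trans_le (min_le_right _ _)))
  exact isStrictlyPositive_smul_rpow_neg_sub hα.1 ⟨ht.1, ht.2.le⟩ (Real.rpow_pos_of_pos hα.1 _)
    (by positivity) (hle hAα) CFC.rpow_nonneg hY
    fun x hx => rpow_neg_lt_mul_rpow_neg hα.1 hs ht.1 ht.2.le hscalar hx
end

section
/- There exist A, B, C ∈ ℙ_2 and t ∈ [0,1] such that d(A ♮_t B, A ♮_t C) > t · d(B, C). That is, the weighted spectral geometric mean does not satisfy the convexity inequality d(A ♮_t B, A ♮_t C) ≤ t d(B, C) for the semi-metric d. -/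
open Matrix
open scoped ComplexOrder

/-- The operator norm (largest singular value) of a matrix, i.e. the norm of the induced
continuous linear endomorphism of Euclidean space. -/
noncomputable def opNorm {n : ℕ} (M : Matrix (Fin n) (Fin n) ℂ) : ℝ :=
  ‖Matrix.toEuclideanCLM (𝕜 := ℂ) M‖

/-- The semi-metric `d(A, B) = 2 ‖log (A⁻¹ # B)‖`. -/
noncomputable def smetric {n : ℕ} (A B : Matrix (Fin n) (Fin n) ℂ) : ℝ :=
  2 * opNorm (mlog (geomMean A⁻¹ B))

lemma mlog_eq_conj {n : ℕ} {A : Matrix (Fin n) (Fin n) ℂ} (hA : A.IsHermitian) :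
    mlog A = (hA.eigenvectorUnitary : Matrix (Fin n) (Fin n) ℂ) *
      Matrix.diagonal (fun i => ((Real.log (hA.eigenvalues i) : ℝ) : ℂ)) *
      (star (hA.eigenvectorUnitary : Matrix (Fin n) (Fin n) ℂ)) :=
  dif_pos hA

section Order

open scoped MatrixOrder Matrix.Norms.L2Operator

lemma Matrix.PosDef.mpow {n : ℕ} {A : Matrix (Fin n) (Fin n) ℂ} (hA : A.PosDef) (t : ℝ) :
    (mpow A t).PosDef := by
  rw [_root_.mpow, dif_pos hA.isHermitian, star_eq_conjTranspose]
  refine (Matrix.PosDef.diagonal fun i => ?_).mul_mul_conjTranspose_same ?_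
  · exact_mod_cast Real.rpow_pos_of_pos (hA.eigenvalues_pos i) t
  · rw [Matrix.vecMul_injective_iff_isUnit]
    exact (Unitary.toUnits hA.isHermitian.eigenvectorUnitary).isUnit

lemma mpow_mul_mpow {n : ℕ} {A : Matrix (Fin n) (Fin n) ℂ} (hA : A.PosDef) (s t : ℝ) :
    mpow A s * mpow A t = mpow A (s + t) := by
  have key (U : unitaryGroup (Fin n) ℂ) (D E : Matrix (Fin n) (Fin n) ℂ) :
      (U : Matrix (Fin n) (Fin n) ℂ) * D * star (U : Matrix (Fin n) (Fin n) ℂ) *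
        ((U : Matrix (Fin n) (Fin n) ℂ) * E * star (U : Matrix (Fin n) (Fin n) ℂ)) =
      (U : Matrix (Fin n) (Fin n) ℂ) * (D * E) * star (U : Matrix (Fin n) (Fin n) ℂ) := by
    have h := Unitary.coe_star_mul_self U
    simp only [mul_assoc]
    rw [← mul_assoc (star (U : Matrix (Fin n) (Fin n) ℂ)) U, h, one_mul]
  simp only [mpow, dif_pos hA.isHermitian]
  rw [key, diagonal_mul_diagonal]
  congr 3
  ext i
  rw [Real.rpow_add (hA.eigenvalues_pos i), Complex.ofReal_mul]

lemma mpow_zero {n : ℕ} {A : Matrix (Fin n) (Fin n) ℂ} (hA : A.PosDef) : mpow A 0 = 1 := by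
  simp [mpow, dif_pos hA.isHermitian]

lemma mpow_one {n : ℕ} {A : Matrix (Fin n) (Fin n) ℂ} (hA : A.PosDef) : mpow A 1 = A := by
  conv_rhs => rw [hA.isHermitian.spectral_theorem, Unitary.conjStarAlgAut_apply]
  simp only [mpow, dif_pos hA.isHermitian, Real.rpow_one]
  rfl

lemma mpow_half_mul_self {n : ℕ} {S : Matrix (Fin n) (Fin n) ℂ} (hS : S.PosDef) :
    mpow (S * S) (1 / 2) = S := by
  have hSS : (S * S).PosDef := by
    have := Matrix.PosDef.conjTranspose_mul_self S
      (Matrix.mulVec_injective_iff_isUnit.2 hS.isUnit)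
    rwa [hS.isHermitian.eq] at this
  have h : mpow (S * S) (1 / 2) * mpow (S * S) (1 / 2) = S * S := by
    rw [mpow_mul_mpow hSS, add_halves, mpow_one hSS]
  rw [← CFC.sqrt_unique h (nonneg_iff_posSemidef.2 (hSS.mpow _).posSemidef),
    CFC.sqrt_mul_self S (nonneg_iff_posSemidef.2 hS.posSemidef)]

lemma opNorm_mlog {n : ℕ} {A : Matrix (Fin n) (Fin n) ℂ} (hA : A.IsHermitian) :
    opNorm (mlog A) = ‖fun i => Real.log (hA.eigenvalues i)‖ := by
  rw [opNorm, ← cstar_norm_def, mlog_eq_conj hA, ← Unitary.coe_star,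
    CStarRing.norm_mul_coe_unitary, CStarRing.norm_coe_unitary_mul, l2_opNorm_diagonal]
  simp [Pi.norm_def, nnnorm]

end Order

/-- `X` is the metric geometric mean of `A⁻¹` and `X A X`. -/
lemma geomMean_inv_mul_mul {n : ℕ} {A X : Matrix (Fin n) (Fin n) ℂ}
    (hA : A.PosDef) (hX : X.PosDef) : geomMean A⁻¹ (X * A * X) = X := by
  have hR := hA.inv.mpow (-(1 / 2))
  have hR' := mpow_mul_mpow hA.inv (1 / 2) (-(1 / 2))
  have hR'' := mpow_mul_mpow hA.inv (-(1 / 2)) (1 / 2)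
  have hRR := mpow_mul_mpow hA.inv (-(1 / 2)) (-(1 / 2))
  have hI := mpow_mul_mpow hA.inv (-1) 1
  rw [mpow_one hA.inv] at hI
  rw [geomMean]
  rw [add_neg_cancel, mpow_zero hA.inv] at hR'
  rw [neg_add_cancel, mpow_zero hA.inv] at hR'' hI
  have hA' : mpow A⁻¹ (-1) = A := by
    have hu := (Matrix.isUnit_iff_isUnit_det _).1 hA.isUnit
    calc mpow A⁻¹ (-1) = mpow A⁻¹ (-1) * (A⁻¹ * A) := by rw [Matrix.nonsing_inv_mul _ hu, mul_one]
      _ = A := by rw [← mul_assoc, hI, one_mul]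
  rw [show (-(1 / 2) + -(1 / 2) : ℝ) = -1 by norm_num, hA'] at hRR
  set R := mpow A⁻¹ (-(1 / 2))
  set T := mpow A⁻¹ (1 / 2)
  have hS : (R * X * R).PosDef := by
    have := hX.mul_mul_conjTranspose_same (B := R)
      (Matrix.vecMul_injective_iff_isUnit.2 hR.isUnit)
    rwa [hR.isHermitian.eq] at this
  have hsq : R * (X * A * X) * R = (R * X * R) * (R * X * R) := by
    rw [← hRR]; simp only [mul_assoc]
  rw [hsq, mpow_half_mul_self hS]
  calc T * (R * X * R) * T = (T * R) * X * (R * T) := by simp only [mul_assoc]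
    _ = X := by rw [hR', hR'', one_mul, mul_one]

lemma smetric_mul_mul {n : ℕ} {A X : Matrix (Fin n) (Fin n) ℂ}
    (hA : A.PosDef) (hX : X.PosDef) :
    smetric A (X * A * X) = 2 * ‖fun i => Real.log (hX.isHermitian.eigenvalues i)‖ := by
  rw [smetric, geomMean_inv_mul_mul hA hX, opNorm_mlog]

lemma spectralMean_half_mul_mul {n : ℕ} {A P : Matrix (Fin n) (Fin n) ℂ}
    (hA : A.PosDef) (hP : P.PosDef) :
    spectralMean (1 / 2) A (P * P * A * (P * P)) = P * A * P := by
  have hPP : (P * P).PosDef := by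
    have := Matrix.PosDef.conjTranspose_mul_self P
      (Matrix.mulVec_injective_iff_isUnit.2 hP.isUnit)
    rwa [hP.isHermitian.eq] at this
  rw [spectralMean, geomMean_inv_mul_mul hA hPP, mpow_half_mul_self hP]

/-- The real symmetric matrix with diagonal entries `a`, `c` and off-diagonal entry `b`. -/
def symmFinTwo (a b c : ℝ) : Matrix (Fin 2) (Fin 2) ℂ :=
  !![(a : ℂ), (b : ℂ); (b : ℂ), (c : ℂ)]

lemma symmFinTwo_mul_self (a b c : ℝ) :
    symmFinTwo a b c * symmFinTwo a b c =
      symmFinTwo (a ^ 2 + b ^ 2) (a * b + b * c) (b ^ 2 + c ^ 2) := by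
  ext i j
  fin_cases i <;> fin_cases j <;> simp [symmFinTwo, Matrix.mul_apply, Fin.sum_univ_two] <;> ring

lemma symmFinTwo_mul_mul (x y z a b c : ℝ) :
    symmFinTwo x y z * symmFinTwo a b c * symmFinTwo x y z =
      symmFinTwo (x ^ 2 * a + 2 * x * y * b + y ^ 2 * c)
        (x * y * a + (x * z + y ^ 2) * b + y * z * c)
        (y ^ 2 * a + 2 * y * z * b + z ^ 2 * c) := by
  ext i j
  fin_cases i <;> fin_cases j <;> simp [symmFinTwo, Matrix.mul_apply, Fin.sum_univ_two] <;> ring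

lemma posDef_symmFinTwo {a b c : ℝ} (ha : 0 < a) (h : b ^ 2 < a * c) :
    (symmFinTwo a b c).PosDef := by
  have hd : (Matrix.diagonal (fun i : Fin 2 => ((![a, c - b ^ 2 / a] i : ℝ) : ℂ))).PosDef := by
    refine Matrix.PosDef.diagonal fun i => ?_
    have : 0 < c - b ^ 2 / a := by
      rw [sub_pos, div_lt_iff₀ ha]; linarith
    rw [Complex.zero_lt_real]
    fin_cases i
    · exact ha
    · exact this
  have hL : IsUnit !![(1 : ℂ), ((b / a : ℝ) : ℂ); 0, 1] := by
    rw [Matrix.isUnit_iff_isUnit_det]; simp [Matrix.det_fin_two]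
  have := hd.conjTranspose_mul_mul_same (Matrix.mulVec_injective_iff_isUnit.2 hL)
  convert this using 1
  have ha' : (a : ℂ) ≠ 0 := by exact_mod_cast ha.ne'
  ext i j
  fin_cases i <;> fin_cases j <;>
    simp [symmFinTwo, Matrix.mul_apply, Fin.sum_univ_two, Matrix.diagonal]
  all_goals field_simp
  ring

lemma eigenvalues_symmFinTwo {a b c : ℝ} (h : (symmFinTwo a b c).IsHermitian) :
    h.eigenvalues 0 + h.eigenvalues 1 = a + c ∧
      h.eigenvalues 0 * h.eigenvalues 1 = a * c - b ^ 2 := by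
  have h1 := h.trace_eq_sum_eigenvalues
  have h2 := h.det_eq_prod_eigenvalues
  have h3 : (symmFinTwo a b c).trace = a + c := by simp [symmFinTwo, Matrix.trace_fin_two]
  have h4 : (symmFinTwo a b c).det = a * c - b * b := by simp [symmFinTwo, Matrix.det_fin_two]
  rw [h3, Fin.sum_univ_two] at h1
  rw [h4, Fin.prod_univ_two] at h2
  constructor
  · apply Complex.ofReal_injective
    simpa using h1.symm
  · apply Complex.ofReal_injective
    simpa [sq] using h2.symm

lemma abs_log_le_of_mul_eq_one {x y c : ℝ} (hx : 0 < x) (hy : 0 < y) (hxy : x * y = 1)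
    (hc : x + y ≤ c) : |Real.log x| ≤ Real.log c := by
  rw [abs_le']
  refine ⟨Real.log_le_log hx (by linarith), ?_⟩
  rw [← Real.log_inv, inv_eq_of_mul_eq_one_right hxy]
  exact Real.log_le_log hy (by linarith)

theorem spectralMean_not_convex : ∃ A B C : Matrix (Fin 2) (Fin 2) ℂ,
    A.PosDef ∧ B.PosDef ∧ C.PosDef ∧ ∃ t ∈ Set.Icc (0 : ℝ) 1,
      t * smetric B C < smetric (spectralMean t A B) (spectralMean t A C) := by
  have hA : (symmFinTwo 1 2 5).PosDef := posDef_symmFinTwo (by norm_num) (by norm_num)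
  have hP : (symmFinTwo 1 0 4).PosDef := posDef_symmFinTwo (by norm_num) (by norm_num)
  have hQ : (symmFinTwo 8 (-2) 1).PosDef := posDef_symmFinTwo (by norm_num) (by norm_num)
  have hB' : (symmFinTwo 1 8 80).PosDef := posDef_symmFinTwo (by norm_num) (by norm_num)
  have hB : (symmFinTwo 1 32 1280).PosDef := posDef_symmFinTwo (by norm_num) (by norm_num)
  have hC : (symmFinTwo 1348 (-346) 89).PosDef := posDef_symmFinTwo (by norm_num) (by norm_num)
  have hZ : (symmFinTwo (146 / 17) (-(21 / 17)) (5 / 17)).PosDef :=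
    posDef_symmFinTwo (by norm_num) (by norm_num)
  have hW : (symmFinTwo 10 (-1) (1 / 5)).PosDef := posDef_symmFinTwo (by norm_num) (by norm_num)
  refine ⟨_, _, _, hA, hB, hC, 1 / 2, ⟨by norm_num, by norm_num⟩, ?_⟩
  have hmB := spectralMean_half_mul_mul hA hP
  have hmC := spectralMean_half_mul_mul hA hQ
  have hd := smetric_mul_mul hB hZ
  have hd' := smetric_mul_mul hB' hW
  simp only [symmFinTwo_mul_self, symmFinTwo_mul_mul] at hmB hmC hd hd'
  norm_num at hmB hmC hd hd'
  have hZle : ‖fun i => Real.log (hZ.isHermitian.eigenvalues i)‖ ≤ Real.log 9 := by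
    obtain ⟨hs, hp⟩ := eigenvalues_symmFinTwo hZ.isHermitian
    have h0 := hZ.eigenvalues_pos 0
    have h1 := hZ.eigenvalues_pos 1
    norm_num at hs hp
    refine (pi_norm_le_iff_of_nonneg (Real.log_nonneg (by norm_num))).2 fun i => ?_
    rw [Real.norm_eq_abs]
    fin_cases i
    · exact abs_log_le_of_mul_eq_one h0 h1 hp (hs.trans_le (by norm_num))
    · exact abs_log_le_of_mul_eq_one h1 h0 (by rw [mul_comm]; exact hp)
        ((add_comm _ _).trans_le (hs.trans_le (by norm_num)))
  have hleW : Real.log 5 ≤ ‖fun i => Real.log (hW.isHermitian.eigenvalues i)‖ := by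
    obtain ⟨hs, -⟩ := eigenvalues_symmFinTwo hW.isHermitian
    obtain ⟨i, hi⟩ : ∃ i, 5 ≤ hW.isHermitian.eigenvalues i := by
      by_contra! h
      linarith [h 0, h 1]
    calc Real.log 5 ≤ Real.log (hW.isHermitian.eigenvalues i) :=
          Real.log_le_log (by norm_num) hi
      _ ≤ ‖Real.log (hW.isHermitian.eigenvalues i)‖ := Real.le_norm_self _
      _ ≤ _ := norm_le_pi_norm (fun i => Real.log (hW.isHermitian.eigenvalues i)) i
  have hlog : Real.log 9 < 2 * Real.log 5 := by
    rw [← Real.log_rpow (by norm_num)]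
    exact Real.log_lt_log (by norm_num) (by norm_num)
  norm_num
  rw [hmB, hmC, hd, hd']
  linarith
end
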